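/- Let β be any one of the nine ★-patterns ★32, 3★2, 32★, ★31, 3★1, 31★, ★21, 2★1, 21★ (those whose two integer entries appear in decreasing order). Then the bidirectional replacement 123 ↔ β has the unraveling property: every permutation is equivalent under 123 ↔ β to some identity permutation id_m. -/

import Mathlib

/-!
Pattern-replacement equivalences between permutations of different lengths
(arXiv:1309.4802). A ★-pattern is encoded as a `List (Option ℕ)`, where `none`
is the placeholder ★ and `some k` an integer entry.
-/

/-- A ★-pattern / star-string entry: `none` is ★, `some k` an integer `k`. -/
abbrev SPat := List (Option ℕ)

/-- The integer entries of a star-string, in order. -/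
def ints (ρ : SPat) : List ℕ := ρ.filterMap id

/-- Two lists of naturals are order-isomorphic. -/
def OrdIso (u v : List ℕ) : Prop :=
  u.length = v.length ∧
  ∀ i j, i < u.length → j < u.length → (u.getD i 0 < u.getD j 0 ↔ v.getD i 0 < v.getD j 0)

/-- A valid string of distinct positive integers and ★'s. -/
def StarStr (ρ : SPat) : Prop := (ints ρ).Nodup ∧ ∀ k ∈ ints ρ, 0 < k

/-- `r` (entry by entry) forms a copy of the ★-pattern `δ`: ★'s in the same
positions, and the integer entries order-isomorphic. -/
def IsCopy (r δ : SPat) : Prop :=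
  r.length = δ.length ∧
  (∀ i, (r.getD i none = none ↔ δ.getD i none = none)) ∧
  OrdIso (ints r) (ints δ)

/-- `Repl a b ρ₁ ρ₂` : `ρ₂` is obtained from `ρ₁` by replacing an occurrence of `a`
as a (not necessarily contiguous) substring of `ρ₁` by `b`, entry by entry at the
same positions. -/
inductive Repl : SPat → SPat → SPat → SPat → Prop
  | nil : Repl [] [] [] []
  | keep {a b ρ₁ ρ₂} (x : Option ℕ) : Repl a b ρ₁ ρ₂ → Repl a b (x :: ρ₁) (x :: ρ₂)
  | repl {a b ρ₁ ρ₂} (x y : Option ℕ) :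
      Repl a b ρ₁ ρ₂ → Repl (x :: a) (y :: b) (x :: ρ₁) (y :: ρ₂)

/-- `π` is a permutation of `1, …, n` (as a list). -/
def IsPermList (π : List ℕ) : Prop := π.Perm (List.range' 1 π.length)

/-- `σ` is a result of the replacement `α → β` applied to the permutation `π`:
(1) `ρ₁` is `π` renumbered (order-isomorphically) with ★'s inserted anywhere;
(2) a substring `a` of `ρ₁` forming a copy of `α` is replaced (in place) by a
string `b` that is a copy of `β`, whose integers meet `ρ₁` only inside `a`, and
which agrees with `a` on the integer entries common to `α` and `β`;
(3) dropping ★'s and renumbering gives the permutation `σ`. -/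
def IsResult (α β : SPat) (π σ : List ℕ) : Prop :=
  ∃ ρ₁ ρ₂ a b : SPat,
    StarStr ρ₁ ∧ OrdIso π (ints ρ₁) ∧
    IsCopy a α ∧
    StarStr b ∧ IsCopy b β ∧
    (∀ k ∈ ints b, k ∈ ints ρ₁ → k ∈ ints a) ∧
    (∀ i j x, α.getD i none = some x → β.getD j none = some x →
      a.getD i none = b.getD j none) ∧
    Repl a b ρ₁ ρ₂ ∧
    IsPermList σ ∧ OrdIso (ints ρ₂) σ

/-- Equivalence under the bidirectional replacement `α ↔ β`: a finite sequence
of `α → β` and `β → α` replacements. -/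
def PermEquiv (α β : SPat) (π σ : List ℕ) : Prop :=
  Relation.ReflTransGen (fun τ υ => IsResult α β τ υ ∨ IsResult β α τ υ) π σ

/-- `π` is isolated under `α ↔ β`: no other permutation is equivalent to it. -/
def Isolated (α β : SPat) (π : List ℕ) : Prop :=
  ∀ σ : List ℕ, IsPermList σ → PermEquiv α β π σ → σ = π

/-- The identity permutation `1 2 ⋯ n`. -/
def idPerm (n : ℕ) : List ℕ := List.range' 1 n

/-- The reverse identity permutation `n (n-1) ⋯ 1`. -/
def ridPerm (n : ℕ) : List ℕ := (List.range' 1 n).reverse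

def pat123 : SPat := [some 1, some 2, some 3]
def pat132 : SPat := [some 1, some 3, some 2]
def patS32 : SPat := [none, some 3, some 2]
def pat3S2 : SPat := [some 3, none, some 2]
def pat32S : SPat := [some 3, some 2, none]
def patS31 : SPat := [none, some 3, some 1]
def pat3S1 : SPat := [some 3, none, some 1]
def pat31S : SPat := [some 3, some 1, none]
def patS21 : SPat := [none, some 2, some 1]
def pat2S1 : SPat := [some 2, none, some 1]
def pat21S : SPat := [some 2, some 1, none]
def pat12S : SPat := [some 1, some 2, none]
def pat1S3 : SPat := [some 1, none, some 3]
def patS23 : SPat := [none, some 2, some 3]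
def patS12 : SPat := [none, some 1, some 2]
def pat23S : SPat := [some 2, some 3, none]
def pat13S : SPat := [some 1, some 3, none]
def pat1S2 : SPat := [some 1, none, some 2]


theorem OrdIso.symm {u v : List ℕ} (h : OrdIso u v) : OrdIso v u :=
  ⟨h.1.symm, fun i j hi hj => (h.2 i j (h.1 ▸ hi) (h.1 ▸ hj)).symm⟩

theorem OrdIso.trans {u v w : List ℕ} (h : OrdIso u v) (k : OrdIso v w) : OrdIso u w :=
  ⟨h.1.trans k.1, fun i j hi hj =>
    (h.2 i j hi hj).trans (k.2 i j (h.1 ▸ hi) (h.1 ▸ hj))⟩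

theorem OrdIso.map {u : List ℕ} (f : ℕ → ℕ) (hf : ∀ a ∈ u, ∀ b ∈ u, (a < b ↔ f a < f b)) :
    OrdIso u (u.map f) := by
  refine ⟨by simp, fun i j hi hj => ?_⟩
  simp only [List.getD_eq_getElem?_getD, List.getElem?_map, List.getElem?_eq_getElem hi,
    List.getElem?_eq_getElem hj, Option.map_some, Option.getD_some]
  exact hf _ (List.getElem_mem hi) _ (List.getElem_mem hj)

/-- Every word with distinct entries has a standardization. -/
theorem exists_std (v : List ℕ) (hv : v.Nodup) : ∃ σ, IsPermList σ ∧ OrdIso v σ := by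
  let f : ℕ → ℕ := fun k => (v.toFinset.filter (· ≤ k)).card
  have hmono : ∀ a b, b ∈ v → a < b → f a < f b := by
    intro a b hb hab
    apply Finset.card_lt_card
    refine ⟨fun t ht => ?_, fun h => ?_⟩
    · simp only [Finset.mem_filter] at ht ⊢
      exact ⟨ht.1, by omega⟩
    · have := h (show b ∈ _ by simp [hb])
      simp at this
      omega
  have hiff : ∀ a ∈ v, ∀ b ∈ v, (a < b ↔ f a < f b) := by
    intro a ha b hb
    refine ⟨hmono a b hb, fun h => ?_⟩
    by_contra hc
    rcases Nat.lt_or_eq_of_le (not_lt.mp hc) with h1 | h1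
    · have := hmono b a ha h1; omega
    · subst h1; omega
  refine ⟨v.map f, ?_, OrdIso.map f hiff⟩
  have hnd : (v.map f).Nodup := by
    refine List.Nodup.map_on (fun a ha b hb hab => ?_) hv
    have h1 := hiff a ha b hb
    have h2 := hiff b hb a ha
    omega
  unfold IsPermList
  refine List.Subperm.perm_of_length_le (hnd.subperm ?_) (by simp)
  intro t ht
  obtain ⟨k, hk, rfl⟩ := List.mem_map.mp ht
  simp only [List.length_map, List.mem_range'_1]
  constructor
  · exact Finset.card_pos.mpr ⟨k, by simp [hk]⟩
  · have : f k ≤ v.toFinset.card := Finset.card_filter_le _ _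
    rw [List.toFinset_card_of_nodup hv] at this
    omega

/-- The standardization of the word `u` is equivalent to an identity. -/
def Good (β : SPat) (u : List ℕ) : Prop :=
  ∀ π, IsPermList π → OrdIso π u → ∃ m : ℕ, PermEquiv pat123 β π (idPerm m)

theorem Good.of_map {β : SPat} {u : List ℕ} (h : Good β (u.map (fun k => 3 * k + 3))) :
    Good β u := fun π hπ ho => h π hπ (ho.trans (OrdIso.map _ (by intros; omega)))

theorem Good.of_sorted {β : SPat} {u : List ℕ} (h : u.Pairwise (· < ·)) : Good β u := by
  intro π hπ ho
  refine ⟨π.length, ?_⟩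
  have hs : π.Pairwise (· < ·) := by
    rw [List.pairwise_iff_getElem] at h ⊢
    intro i j hi hj hij
    have h1 := h i j (ho.1 ▸ hi) (ho.1 ▸ hj) hij
    have h2 := ho.2 i j hi hj
    simp only [List.getD_eq_getElem?_getD, List.getElem?_eq_getElem hi,
      List.getElem?_eq_getElem hj, List.getElem?_eq_getElem (ho.1 ▸ hi : i < u.length),
      List.getElem?_eq_getElem (ho.1 ▸ hj : j < u.length), Option.getD_some] at h2
    exact h2.mpr h1
  have : π = idPerm π.length := by
    refine List.Perm.eq_of_pairwise (le := (· < ·)) ?_ hs ?_ hπ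
    · intro a b _ _ h1 h2; omega
    · exact List.pairwise_lt_range'
  rw [← this]
  exact Relation.ReflTransGen.refl

theorem ints_append (u v : SPat) : ints (u ++ v) = ints u ++ ints v := by simp [ints]
theorem ints_map (u : List ℕ) : ints (u.map some) = u := by
  simp [ints, List.filterMap_map]
theorem ints_cons (o : Option ℕ) (v : SPat) : ints (o :: v) = o.toList ++ ints v := by
  cases o <;> simp [ints]
theorem ints_nil : ints [] = [] := rfl

theorem Repl.keeps {a b ρ₁ ρ₂ : SPat} (X : SPat) (h : Repl a b ρ₁ ρ₂) :
    Repl a b (X ++ ρ₁) (X ++ ρ₂) := by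
  induction X with
  | nil => exact h
  | cons x X ih => exact ih.keep x

theorem Repl.same (X : SPat) : Repl [] [] X X := by
  induction X with
  | nil => exact .nil
  | cons x X ih => exact ih.keep x

theorem copy123 {x y z : ℕ} (h1 : x < y) (h2 : y < z) :
    IsCopy [some x, some y, some z] pat123 := by
  refine ⟨rfl, ?_, rfl, ?_⟩
  · rintro (_ | _ | _ | i) <;> simp [pat123]
  · intro i j hi hj
    simp [ints] at hi hj
    interval_cases i <;> interval_cases j <;> simp [ints, pat123] <;> omega

/-- The word-level replacement step `β → 123`. -/
theorem step_core {β : SPat} (a₁ a₂ a₃ : Option ℕ) (X₀ X₁ X₂ X₃ : List ℕ) {x y z : ℕ}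
    (hx : 0 < x) (hxy : x < y) (hyz : y < z)
    (hpos : ∀ k ∈ X₀ ++ X₁ ++ X₂ ++ X₃, 0 < k)
    (hnd : (X₀ ++ x :: X₁ ++ y :: X₂ ++ z :: X₃).Nodup)
    (hcopy : IsCopy [a₁, a₂, a₃] β)
    (hnd' : (a₁.toList ++ a₂.toList ++ a₃.toList).Nodup)
    (hsub : ∀ k ∈ a₁.toList ++ a₂.toList ++ a₃.toList, k = x ∨ k = y ∨ k = z)
    (hagree : ∀ i j t, β.getD i none = some t → pat123.getD j none = some t →
      [a₁, a₂, a₃].getD i none = [some x, some y, some z].getD j none)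
    (hG : Good β (X₀ ++ x :: X₁ ++ y :: X₂ ++ z :: X₃)) :
    Good β (X₀ ++ a₁.toList ++ X₁ ++ a₂.toList ++ X₂ ++ a₃.toList ++ X₃) := by
  intro π hπ ho
  obtain ⟨σ, hσ, hvσ⟩ := exists_std _ hnd
  obtain ⟨m, hm⟩ := hG σ hσ hvσ.symm
  refine ⟨m, Relation.ReflTransGen.head (Or.inr ?_) hm⟩
  have e1 : ints (X₀.map some ++ a₁ :: (X₁.map some ++ a₂ :: (X₂.map some ++
      a₃ :: X₃.map some))) =
      X₀ ++ a₁.toList ++ X₁ ++ a₂.toList ++ X₂ ++ a₃.toList ++ X₃ := by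
    simp [ints_append, ints_map, ints_cons]
  have e2 : ints (X₀.map some ++ some x :: (X₁.map some ++ some y :: (X₂.map some ++
      some z :: X₃.map some))) = X₀ ++ x :: X₁ ++ y :: X₂ ++ z :: X₃ := by
    simp [ints_append, ints_map, ints_cons]
  have e3 : ints [a₁, a₂, a₃] = a₁.toList ++ a₂.toList ++ a₃.toList := by
    simp [ints_cons, ints_nil]
  have e4 : ints [some x, some y, some z] = [x, y, z] := rfl
  refine ⟨X₀.map some ++ a₁ :: (X₁.map some ++ a₂ :: (X₂.map some ++ a₃ :: X₃.map some)),
    X₀.map some ++ some x :: (X₁.map some ++ some y :: (X₂.map some ++ some z :: X₃.map some)),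
    [a₁, a₂, a₃], [some x, some y, some z], ?_, ?_, hcopy, ?_, copy123 hxy hyz, ?_,
    hagree, ?_, hσ, ?_⟩
  · rw [StarStr, e1]
    constructor
    · have p1 : (X₀ ++ a₁.toList ++ X₁ ++ a₂.toList ++ X₂ ++ a₃.toList ++ X₃).Perm
        ((a₁.toList ++ a₂.toList ++ a₃.toList) ++ (X₀ ++ X₁ ++ X₂ ++ X₃)) := by
        rw [List.perm_iff_count]; intro t; simp only [List.count_append]; omega
      have p2 : (X₀ ++ x :: X₁ ++ y :: X₂ ++ z :: X₃).Perm
        ([x, y, z] ++ (X₀ ++ X₁ ++ X₂ ++ X₃)) := by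
        rw [List.perm_iff_count]; intro t
        simp only [List.count_append, List.count_cons, List.count_nil]; omega
      rw [p1.nodup_iff, List.nodup_append]
      rw [p2.nodup_iff, List.nodup_append] at hnd
      refine ⟨hnd', hnd.2.1, fun a ha b hb => hnd.2.2 a ?_ b hb⟩
      simpa using hsub a ha
    · intro k hk
      by_cases h : k ∈ X₀ ++ X₁ ++ X₂ ++ X₃
      · exact hpos k h
      · have : k ∈ a₁.toList ++ a₂.toList ++ a₃.toList := by
          simp only [List.mem_append] at hk h ⊢; tauto
        have := hsub k this
        omega
  · rw [e1]; exact ho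
  · rw [StarStr, e4]
    constructor
    · simp; omega
    · simp; omega
  · rw [e1, e3, e4]
    intro k hk hk'
    have p2 : (X₀ ++ x :: X₁ ++ y :: X₂ ++ z :: X₃).Perm
      ([x, y, z] ++ (X₀ ++ X₁ ++ X₂ ++ X₃)) := by
      rw [List.perm_iff_count]; intro t
      simp only [List.count_append, List.count_cons, List.count_nil]; omega
    rw [p2.nodup_iff, List.nodup_append] at hnd
    have h : k ∉ X₀ ++ X₁ ++ X₂ ++ X₃ := fun h => hnd.2.2 k hk k h rfl
    simp only [List.mem_append] at hk' h ⊢; tauto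
  · exact Repl.keeps _ (.repl _ _ (Repl.keeps _ (.repl _ _ (Repl.keeps _
      (.repl _ _ (Repl.same _))))))
  · rw [e2]; exact hvσ

theorem step_S32 (X₀ X₁ X₂ X₃ : List ℕ) {x y z : ℕ}
    (hx : 0 < x) (hxy : x < y) (hyz : y < z)
    (hpos : ∀ k ∈ X₀ ++ X₁ ++ X₂ ++ X₃, 0 < k)
    (hnd : (X₀ ++ x :: X₁ ++ y :: X₂ ++ z :: X₃).Nodup)
    (hG : Good patS32 (X₀ ++ x :: X₁ ++ y :: X₂ ++ z :: X₃)) :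
    Good patS32 (X₀ ++ X₁ ++ z :: X₂ ++ y :: X₃) := by
  have := step_core (β := patS32) none (some z) (some y) X₀ X₁ X₂ X₃ hx hxy hyz hpos hnd
    (by
      refine ⟨rfl, ?_, rfl, ?_⟩
      · rintro (_ | _ | _ | i) <;> simp [patS32]
      · intro i j hi hj
        simp [ints] at hi hj
        interval_cases i <;> interval_cases j <;> simp [ints, patS32] <;> omega)
    (by simp; try omega)
    (by simp)
    (by rintro (_ | _ | _ | i) (_ | _ | _ | j) t <;> simp [patS32, pat123] <;> omega) hG
  simpa using this

theorem step_3S2 (X₀ X₁ X₂ X₃ : List ℕ) {x y z : ℕ}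
    (hx : 0 < x) (hxy : x < y) (hyz : y < z)
    (hpos : ∀ k ∈ X₀ ++ X₁ ++ X₂ ++ X₃, 0 < k)
    (hnd : (X₀ ++ x :: X₁ ++ y :: X₂ ++ z :: X₃).Nodup)
    (hG : Good pat3S2 (X₀ ++ x :: X₁ ++ y :: X₂ ++ z :: X₃)) :
    Good pat3S2 (X₀ ++ z :: X₁ ++ X₂ ++ y :: X₃) := by
  have := step_core (β := pat3S2) (some z) none (some y) X₀ X₁ X₂ X₃ hx hxy hyz hpos hnd
    (by
      refine ⟨rfl, ?_, rfl, ?_⟩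
      · rintro (_ | _ | _ | i) <;> simp [pat3S2]
      · intro i j hi hj
        simp [ints] at hi hj
        interval_cases i <;> interval_cases j <;> simp [ints, pat3S2] <;> omega)
    (by simp; try omega)
    (by simp)
    (by rintro (_ | _ | _ | i) (_ | _ | _ | j) t <;> simp [pat3S2, pat123] <;> omega) hG
  simpa using this

theorem step_32S (X₀ X₁ X₂ X₃ : List ℕ) {x y z : ℕ}
    (hx : 0 < x) (hxy : x < y) (hyz : y < z)
    (hpos : ∀ k ∈ X₀ ++ X₁ ++ X₂ ++ X₃, 0 < k)
    (hnd : (X₀ ++ x :: X₁ ++ y :: X₂ ++ z :: X₃).Nodup)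
    (hG : Good pat32S (X₀ ++ x :: X₁ ++ y :: X₂ ++ z :: X₃)) :
    Good pat32S (X₀ ++ z :: X₁ ++ y :: X₂ ++ X₃) := by
  have := step_core (β := pat32S) (some z) (some y) none X₀ X₁ X₂ X₃ hx hxy hyz hpos hnd
    (by
      refine ⟨rfl, ?_, rfl, ?_⟩
      · rintro (_ | _ | _ | i) <;> simp [pat32S]
      · intro i j hi hj
        simp [ints] at hi hj
        interval_cases i <;> interval_cases j <;> simp [ints, pat32S] <;> omega)
    (by simp; try omega)
    (by simp)
    (by rintro (_ | _ | _ | i) (_ | _ | _ | j) t <;> simp [pat32S, pat123] <;> omega) hG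
  simpa using this

theorem step_S31 (X₀ X₁ X₂ X₃ : List ℕ) {x y z : ℕ}
    (hx : 0 < x) (hxy : x < y) (hyz : y < z)
    (hpos : ∀ k ∈ X₀ ++ X₁ ++ X₂ ++ X₃, 0 < k)
    (hnd : (X₀ ++ x :: X₁ ++ y :: X₂ ++ z :: X₃).Nodup)
    (hG : Good patS31 (X₀ ++ x :: X₁ ++ y :: X₂ ++ z :: X₃)) :
    Good patS31 (X₀ ++ X₁ ++ z :: X₂ ++ x :: X₃) := by
  have := step_core (β := patS31) none (some z) (some x) X₀ X₁ X₂ X₃ hx hxy hyz hpos hnd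
    (by
      refine ⟨rfl, ?_, rfl, ?_⟩
      · rintro (_ | _ | _ | i) <;> simp [patS31]
      · intro i j hi hj
        simp [ints] at hi hj
        interval_cases i <;> interval_cases j <;> simp [ints, patS31] <;> omega)
    (by simp; try omega)
    (by simp)
    (by rintro (_ | _ | _ | i) (_ | _ | _ | j) t <;> simp [patS31, pat123] <;> omega) hG
  simpa using this

theorem step_3S1 (X₀ X₁ X₂ X₃ : List ℕ) {x y z : ℕ}
    (hx : 0 < x) (hxy : x < y) (hyz : y < z)
    (hpos : ∀ k ∈ X₀ ++ X₁ ++ X₂ ++ X₃, 0 < k)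
    (hnd : (X₀ ++ x :: X₁ ++ y :: X₂ ++ z :: X₃).Nodup)
    (hG : Good pat3S1 (X₀ ++ x :: X₁ ++ y :: X₂ ++ z :: X₃)) :
    Good pat3S1 (X₀ ++ z :: X₁ ++ X₂ ++ x :: X₃) := by
  have := step_core (β := pat3S1) (some z) none (some x) X₀ X₁ X₂ X₃ hx hxy hyz hpos hnd
    (by
      refine ⟨rfl, ?_, rfl, ?_⟩
      · rintro (_ | _ | _ | i) <;> simp [pat3S1]
      · intro i j hi hj
        simp [ints] at hi hj
        interval_cases i <;> interval_cases j <;> simp [ints, pat3S1] <;> omega)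
    (by simp; try omega)
    (by simp)
    (by rintro (_ | _ | _ | i) (_ | _ | _ | j) t <;> simp [pat3S1, pat123] <;> omega) hG
  simpa using this

theorem step_31S (X₀ X₁ X₂ X₃ : List ℕ) {x y z : ℕ}
    (hx : 0 < x) (hxy : x < y) (hyz : y < z)
    (hpos : ∀ k ∈ X₀ ++ X₁ ++ X₂ ++ X₃, 0 < k)
    (hnd : (X₀ ++ x :: X₁ ++ y :: X₂ ++ z :: X₃).Nodup)
    (hG : Good pat31S (X₀ ++ x :: X₁ ++ y :: X₂ ++ z :: X₃)) :
    Good pat31S (X₀ ++ z :: X₁ ++ x :: X₂ ++ X₃) := by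
  have := step_core (β := pat31S) (some z) (some x) none X₀ X₁ X₂ X₃ hx hxy hyz hpos hnd
    (by
      refine ⟨rfl, ?_, rfl, ?_⟩
      · rintro (_ | _ | _ | i) <;> simp [pat31S]
      · intro i j hi hj
        simp [ints] at hi hj
        interval_cases i <;> interval_cases j <;> simp [ints, pat31S] <;> omega)
    (by simp; try omega)
    (by simp)
    (by rintro (_ | _ | _ | i) (_ | _ | _ | j) t <;> simp [pat31S, pat123] <;> omega) hG
  simpa using this

theorem step_S21 (X₀ X₁ X₂ X₃ : List ℕ) {x y z : ℕ}
    (hx : 0 < x) (hxy : x < y) (hyz : y < z)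
    (hpos : ∀ k ∈ X₀ ++ X₁ ++ X₂ ++ X₃, 0 < k)
    (hnd : (X₀ ++ x :: X₁ ++ y :: X₂ ++ z :: X₃).Nodup)
    (hG : Good patS21 (X₀ ++ x :: X₁ ++ y :: X₂ ++ z :: X₃)) :
    Good patS21 (X₀ ++ X₁ ++ y :: X₂ ++ x :: X₃) := by
  have := step_core (β := patS21) none (some y) (some x) X₀ X₁ X₂ X₃ hx hxy hyz hpos hnd
    (by
      refine ⟨rfl, ?_, rfl, ?_⟩
      · rintro (_ | _ | _ | i) <;> simp [patS21]
      · intro i j hi hj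
        simp [ints] at hi hj
        interval_cases i <;> interval_cases j <;> simp [ints, patS21] <;> omega)
    (by simp; try omega)
    (by simp)
    (by rintro (_ | _ | _ | i) (_ | _ | _ | j) t <;> simp [patS21, pat123] <;> omega) hG
  simpa using this

theorem step_2S1 (X₀ X₁ X₂ X₃ : List ℕ) {x y z : ℕ}
    (hx : 0 < x) (hxy : x < y) (hyz : y < z)
    (hpos : ∀ k ∈ X₀ ++ X₁ ++ X₂ ++ X₃, 0 < k)
    (hnd : (X₀ ++ x :: X₁ ++ y :: X₂ ++ z :: X₃).Nodup)
    (hG : Good pat2S1 (X₀ ++ x :: X₁ ++ y :: X₂ ++ z :: X₃)) :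
    Good pat2S1 (X₀ ++ y :: X₁ ++ X₂ ++ x :: X₃) := by
  have := step_core (β := pat2S1) (some y) none (some x) X₀ X₁ X₂ X₃ hx hxy hyz hpos hnd
    (by
      refine ⟨rfl, ?_, rfl, ?_⟩
      · rintro (_ | _ | _ | i) <;> simp [pat2S1]
      · intro i j hi hj
        simp [ints] at hi hj
        interval_cases i <;> interval_cases j <;> simp [ints, pat2S1] <;> omega)
    (by simp; try omega)
    (by simp)
    (by rintro (_ | _ | _ | i) (_ | _ | _ | j) t <;> simp [pat2S1, pat123] <;> omega) hG
  simpa using this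

theorem step_21S (X₀ X₁ X₂ X₃ : List ℕ) {x y z : ℕ}
    (hx : 0 < x) (hxy : x < y) (hyz : y < z)
    (hpos : ∀ k ∈ X₀ ++ X₁ ++ X₂ ++ X₃, 0 < k)
    (hnd : (X₀ ++ x :: X₁ ++ y :: X₂ ++ z :: X₃).Nodup)
    (hG : Good pat21S (X₀ ++ x :: X₁ ++ y :: X₂ ++ z :: X₃)) :
    Good pat21S (X₀ ++ y :: X₁ ++ x :: X₂ ++ X₃) := by
  have := step_core (β := pat21S) (some y) (some x) none X₀ X₁ X₂ X₃ hx hxy hyz hpos hnd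
    (by
      refine ⟨rfl, ?_, rfl, ?_⟩
      · rintro (_ | _ | _ | i) <;> simp [pat21S]
      · intro i j hi hj
        simp [ints] at hi hj
        interval_cases i <;> interval_cases j <;> simp [ints, pat21S] <;> omega)
    (by simp; try omega)
    (by simp)
    (by rintro (_ | _ | _ | i) (_ | _ | _ | j) t <;> simp [pat21S, pat123] <;> omega) hG
  simpa using this


theorem exists_min (w : List ℕ) (h : w ≠ []) : ∃ C m B, w = C ++ m :: B ∧ ∀ k ∈ w, m ≤ k := by
  obtain ⟨m, hm, hmin⟩ := w.toFinset.exists_min_image id (by simpa using h)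
  obtain ⟨C, B, rfl⟩ := List.append_of_mem (List.mem_toFinset.mp hm)
  exact ⟨C, m, B, rfl, fun k hk => hmin k (List.mem_toFinset.mpr hk)⟩

theorem exists_max (w : List ℕ) (h : w ≠ []) : ∃ C m B, w = C ++ m :: B ∧ ∀ k ∈ w, k ≤ m := by
  obtain ⟨m, hm, hmin⟩ := w.toFinset.exists_max_image id (by simpa using h)
  obtain ⟨C, B, rfl⟩ := List.append_of_mem (List.mem_toFinset.mp hm)
  exact ⟨C, m, B, rfl, fun k hk => hmin k (List.mem_toFinset.mpr hk)⟩

/-- sorted prefix condition -/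
def Pre (P w : List ℕ) : Prop :=
  P.Pairwise (· < ·) ∧ w.Nodup ∧ ∀ p ∈ P, ∀ q ∈ w, p < q

/-- sorted suffix condition -/
def Suf (w P : List ℕ) : Prop :=
  P.Pairwise (· < ·) ∧ w.Nodup ∧ ∀ p ∈ P, ∀ q ∈ w, q < p

theorem Pre.nodup {P w : List ℕ} (h : Pre P w) : (P ++ w).Nodup := by
  rw [List.nodup_append]
  exact ⟨h.1.imp (fun h => h.ne), h.2.1, fun a ha b hb => (h.2.2 a ha b hb).ne⟩

theorem Suf.nodup {P w : List ℕ} (h : Suf w P) : (w ++ P).Nodup := by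
  rw [List.nodup_append]
  exact ⟨h.2.1, h.1.imp (fun h => h.ne), fun a ha b hb => (h.2.2 b hb a ha).ne⟩

theorem Pre.map {P w : List ℕ} (h : Pre P w) :
    Pre (P.map (fun k => 3 * k + 3)) (w.map (fun k => 3 * k + 3)) := by
  refine ⟨?_, ?_, ?_⟩
  · rw [List.pairwise_map]; exact h.1.imp (by intros; omega)
  · exact h.2.1.map (fun a b hab => by simp at hab; omega)
  · simp only [List.mem_map]
    rintro _ ⟨p, hp, rfl⟩ _ ⟨q, hq, rfl⟩
    have := h.2.2 p hp q hq; omega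

theorem Suf.map {P w : List ℕ} (h : Suf w P) :
    Suf (w.map (fun k => 3 * k + 3)) (P.map (fun k => 3 * k + 3)) := by
  refine ⟨?_, ?_, ?_⟩
  · rw [List.pairwise_map]; exact h.1.imp (by intros; omega)
  · exact h.2.1.map (fun a b hab => by simp at hab; omega)
  · simp only [List.mem_map]
    rintro _ ⟨p, hp, rfl⟩ _ ⟨q, hq, rfl⟩
    have := h.2.2 p hp q hq; omega

/-- move a minimum at the front of `w` into the prefix -/
theorem Pre.shift {P w : List ℕ} {m : ℕ} (h : Pre P (m :: w)) (hm : ∀ k ∈ w, m < k) :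
    Pre (P ++ [m]) w := by
  obtain ⟨h1, h2, h3⟩ := h
  refine ⟨?_, (List.nodup_cons.mp h2).2, ?_⟩
  · rw [List.pairwise_append]
    refine ⟨h1, by simp, fun a ha b hb => ?_⟩
    simp at hb; subst hb; exact h3 a ha _ (by simp)
  · intro p hp q hq
    rcases List.mem_append.mp hp with h | h
    · exact h3 p h q (by simp [hq])
    · simp at h; subst h; exact hm q hq

theorem Suf.shift {P w : List ℕ} {m : ℕ} (h : Suf (w ++ [m]) P) (hm : ∀ k ∈ w, k < m) :
    Suf w (m :: P) := by
  obtain ⟨h1, h2, h3⟩ := h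
  refine ⟨?_, (List.nodup_append.mp h2).1, ?_⟩
  · rw [List.pairwise_cons]
    exact ⟨fun a ha => h3 a ha m (by simp), h1⟩
  · intro p hp q hq
    rcases List.mem_cons.mp hp with h | h
    · subst h; exact hm q hq
    · exact h3 p h q (by simp [hq])

/-- Insert a new value just below the front of `w`. -/
theorem Pre.perm {P w w' : List ℕ} (h : Pre P w) (hw : w.Perm w') : Pre P w' :=
  ⟨h.1, hw.nodup_iff.mp h.2.1, fun p hp q hq => h.2.2 p hp q (hw.mem_iff.mpr hq)⟩

theorem Suf.perm {P w w' : List ℕ} (h : Suf w P) (hw : w.Perm w') : Suf w' P :=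
  ⟨h.1, hw.nodup_iff.mp h.2.1, fun p hp q hq => h.2.2 p hp q (hw.mem_iff.mpr hq)⟩

theorem Pre.insert {P w : List ℕ} {c : ℕ} (h : Pre P w) (h1 : ∀ p ∈ P, p < c) (h2 : c ∉ w) :
    Pre P (c :: w) := by
  refine ⟨h.1, List.nodup_cons.mpr ⟨h2, h.2.1⟩, fun p hp q hq => ?_⟩
  rcases List.mem_cons.mp hq with h' | h'
  · subst h'; exact h1 p hp
  · exact h.2.2 p hp q h'

theorem Suf.insert {P w : List ℕ} {c : ℕ} (h : Suf w P) (h1 : ∀ p ∈ P, c < p) (h2 : c ∉ w) :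
    Suf (c :: w) P := by
  refine ⟨h.1, List.nodup_cons.mpr ⟨h2, h.2.1⟩, fun p hp q hq => ?_⟩
  rcases List.mem_cons.mp hq with h' | h'
  · subst h'; exact h1 p hp
  · exact h.2.2 p hp q h'

theorem min_lt {C B : List ℕ} {m : ℕ} (hnd : (C ++ m :: B).Nodup)
    (hm : ∀ k ∈ C ++ m :: B, m ≤ k) : ∀ k ∈ C ++ B, m < k := by
  intro k hk
  have h1 : (C ++ m :: B).Perm (m :: (C ++ B)) := List.perm_middle
  have h2 := (List.nodup_cons.mp (h1.nodup_iff.mp hnd)).1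
  refine lt_of_le_of_ne (hm k (h1.mem_iff.mpr (by simp only [List.mem_cons]; tauto))) ?_
  rintro rfl; exact h2 hk

theorem lt_max {C B : List ℕ} {m : ℕ} (hnd : (C ++ m :: B).Nodup)
    (hm : ∀ k ∈ C ++ m :: B, k ≤ m) : ∀ k ∈ C ++ B, k < m := by
  intro k hk
  have h1 : (C ++ m :: B).Perm (m :: (C ++ B)) := List.perm_middle
  have h2 := (List.nodup_cons.mp (h1.nodup_iff.mp hnd)).1
  refine lt_of_le_of_ne (hm k (h1.mem_iff.mpr (by simp only [List.mem_cons]; tauto))) ?_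
  rintro rfl; exact h2 hk

/-- Prefix induction, for `★32, ★31, 3★2, 3★1`. -/
theorem prefix_induction (β : SPat)
    (H : (∀ (P A B : List ℕ) (x y z : ℕ), 0 < x → x < y → y < z →
        (∀ k ∈ P ++ A ++ B, 0 < k) → (P ++ x :: y :: (A ++ z :: B)).Nodup →
        Good β (P ++ x :: y :: (A ++ z :: B)) → Good β (P ++ z :: (A ++ y :: B))) ∨
      (∀ (P A B : List ℕ) (x y z : ℕ), 0 < x → x < y → y < z →
        (∀ k ∈ P ++ A ++ B, 0 < k) → (P ++ x :: y :: (A ++ z :: B)).Nodup →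
        Good β (P ++ x :: y :: (A ++ z :: B)) → Good β (P ++ z :: (A ++ x :: B)))) :
    ∀ (n : ℕ) (P w : List ℕ), w.length = n → Pre P w → Good β (P ++ w) := by
  intro n
  induction n with
  | zero =>
    intro P w hw h
    obtain rfl := List.length_eq_zero_iff.mp hw
    simpa using Good.of_sorted h.1
  | succ n ih =>
    intro P w hw h
    obtain ⟨C, m, B, rfl, hm⟩ := exists_min w (by rintro rfl; simp at hw)
    have hlt := min_lt h.2.1 hm
    rcases C with _ | ⟨z, A⟩
    · have := ih (P ++ [m]) B (by simpa using hw) (Pre.shift h hlt)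
      simpa using this
    · apply Good.of_map
      have hM := h.map
      have hz : m < z := hlt z (by simp)
      set f : ℕ → ℕ := fun k => 3 * k + 3 with hf
      have hw' : (A.map f ++ f z :: B.map f).length = n := by simp at hw ⊢; omega
      have hperm : (f m :: (A.map f ++ f z :: B.map f)).Perm
          (((z :: A) ++ m :: B).map f) := by
        rw [List.perm_iff_count]; intro t
        simp only [List.map_append, List.map_cons, List.count_append, List.count_cons]; omega
      have hM1 := hM.perm hperm.symm
      have hgt : ∀ k ∈ A.map f ++ f z :: B.map f, f m + 1 < k := by
        intro k hk
        have : k ∈ (A ++ z :: B).map f := by simpa using hk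
        obtain ⟨q, hq, rfl⟩ := List.mem_map.mp this
        have := hlt q (by simp at hq ⊢; tauto)
        simp only [hf]; omega
      have hpos : ∀ k ∈ P.map f ++ A.map f ++ B.map f, 0 < k := by
        intro k hk
        have : k ∈ (P ++ A ++ B).map f := by simpa using hk
        obtain ⟨q, hq, rfl⟩ := List.mem_map.mp this
        simp only [hf]; omega
      have hPm : ∀ p ∈ P.map f, p < f m - 1 := by
        intro p hp
        obtain ⟨q, hq, rfl⟩ := List.mem_map.mp hp
        have := h.2.2 q hq m (by simp)
        simp only [hf]; omega
      have hmz : f m + 1 < f z := by simp only [hf]; omega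
      have hm0 : 2 < f m := by simp only [hf]; omega
      rcases H with H | H
      · have := H (P.map f) (A.map f) (B.map f) (f m - 1) (f m) (f z) (by omega) (by omega)
          (by omega) hpos
        have hI : Pre (P.map f) ((f m - 1) :: f m :: (A.map f ++ f z :: B.map f)) := by
          refine hM1.insert hPm ?_
          intro hc
          rcases List.mem_cons.mp hc with hc | hc
          · omega
          · have := hgt _ hc; omega
        have hI2 := (hI.shift (by
            intro k hk
            rcases List.mem_cons.mp hk with hc | hc
            · omega
            · have := hgt _ hc; omega)).shift (fun k hk => by have := hgt _ hk; omega)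
        have hg := ih _ _ hw' hI2
        simpa using this hI.nodup (by simpa using hg)
      · have := H (P.map f) (A.map f) (B.map f) (f m) (f m + 1) (f z) (by omega) (by omega)
          (by omega) hpos
        have hI : Pre (P.map f) ((f m) :: (f m + 1) :: (A.map f ++ f z :: B.map f)) := by
          refine Pre.perm (hM1.insert (c := f m + 1) (fun p hp => by have := hPm p hp; omega) ?_)
            (List.Perm.swap _ _ _)
          intro hc
          rcases List.mem_cons.mp hc with hc | hc
          · omega
          · have := hgt _ hc; omega
        have hI2 := (hI.shift (by
            intro k hk
            rcases List.mem_cons.mp hk with hc | hc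
            · omega
            · have := hgt _ hc; omega)).shift (fun k hk => hgt _ hk)
        have hg := ih _ _ hw' hI2
        simpa using this hI.nodup (by simpa using hg)

/-- Suffix induction, for `21★, 31★, 2★1`. -/
theorem suffix_induction (β : SPat)
    (H : (∀ (P A B : List ℕ) (x y z : ℕ), 0 < x → x < y → y < z →
        (∀ k ∈ A ++ B ++ P, 0 < k) → (A ++ x :: B ++ y :: z :: P).Nodup →
        Good β (A ++ x :: B ++ y :: z :: P) → Good β (A ++ y :: B ++ x :: P)) ∨
      (∀ (P A B : List ℕ) (x y z : ℕ), 0 < x → x < y → y < z →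
        (∀ k ∈ A ++ B ++ P, 0 < k) → (A ++ x :: B ++ y :: z :: P).Nodup →
        Good β (A ++ x :: B ++ y :: z :: P) → Good β (A ++ z :: B ++ x :: P))) :
    ∀ (n : ℕ) (P w : List ℕ), w.length = n → Suf w P → Good β (w ++ P) := by
  intro n
  induction n with
  | zero =>
    intro P w hw h
    obtain rfl := List.length_eq_zero_iff.mp hw
    simpa using Good.of_sorted h.1
  | succ n ih =>
    intro P w hw h
    obtain ⟨A, m, C, rfl, hm⟩ := exists_max w (by rintro rfl; simp at hw)
    have hlt := lt_max h.2.1 hm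
    rcases List.eq_nil_or_concat C with rfl | ⟨B, x, rfl⟩
    · have := ih (m :: P) A (by simpa using hw) (Suf.shift h (by simpa using hlt))
      simpa using this
    · apply Good.of_map
      have hM := h.map
      have hz : x < m := hlt x (by simp)
      set f : ℕ → ℕ := fun k => 3 * k + 3 with hf
      have hw' : (A.map f ++ f x :: B.map f).length = n := by simp at hw ⊢; omega
      have hperm : (f m :: (A.map f ++ f x :: B.map f)).Perm
          ((A ++ m :: (B ++ [x])).map f) := by
        rw [List.perm_iff_count]; intro t
        simp only [List.map_append, List.map_cons, List.count_append, List.count_cons,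
          List.map_nil, List.count_nil]; omega
      rw [List.concat_eq_append] at hM
      have hM1 := hM.perm hperm.symm
      have hgt : ∀ k ∈ A.map f ++ f x :: B.map f, k + 1 < f m := by
        intro k hk
        have : k ∈ (A ++ x :: B).map f := by simpa using hk
        obtain ⟨q, hq, rfl⟩ := List.mem_map.mp this
        have := hlt q (by simp at hq ⊢; tauto)
        simp only [hf]; omega
      have hpos : ∀ k ∈ A.map f ++ B.map f ++ P.map f, 0 < k := by
        intro k hk
        have : k ∈ (A ++ B ++ P).map f := by simpa using hk
        obtain ⟨q, hq, rfl⟩ := List.mem_map.mp this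
        simp only [hf]; omega
      have hPm : ∀ p ∈ P.map f, f m + 1 < p := by
        intro p hp
        obtain ⟨q, hq, rfl⟩ := List.mem_map.mp hp
        have := h.2.2 q hq m (by simp)
        simp only [hf]; omega
      have hmz : f x + 1 < f m := by simp only [hf]; omega
      have hm0 : 2 < f x := by simp only [hf]; omega
      have key : ∀ y z, y < z → (∀ k ∈ A.map f ++ f x :: B.map f, k < y) →
          (∀ p ∈ P.map f, z < p) →
          Suf (A.map f ++ f x :: B.map f ++ [y] ++ [z]) (P.map f) := by
        intro y z hyz h1 h2
        have hS : Suf (A.map f ++ f x :: B.map f) (P.map f) :=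
          ⟨hM1.1, (List.nodup_cons.mp hM1.2.1).2,
            fun p hp q hq => hM1.2.2 p hp q (List.mem_cons_of_mem _ hq)⟩
        refine Suf.perm (Suf.insert (c := z) (Suf.insert (c := y) hS
          (fun p hp => hyz.trans (h2 p hp)) (fun hc => (h1 _ hc).false)) h2 ?_) ?_
        · intro hc
          rcases List.mem_cons.mp hc with hc | hc
          · omega
          · have := h1 _ hc; omega
        · rw [List.perm_iff_count]; intro t
          simp only [List.count_append, List.count_cons, List.count_nil]; omega
      rcases H with H | H
      · have := H (P.map f) (A.map f) (B.map f) (f x) (f m) (f m + 1) (by omega) (by omega)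
          (by omega) hpos
        have hI := key (f m) (f m + 1) (by omega) (fun k hk => by have := hgt k hk; omega) hPm
        have hI2 := (hI.shift (by
            intro k hk
            rcases List.mem_append.mp hk with hc | hc
            · have := hgt _ hc; omega
            · simp at hc; omega)).shift (fun k hk => by have := hgt _ hk; omega)
        have hg := ih _ _ hw' hI2
        simpa using this (by simpa using hI.nodup) (by simpa using hg)
      · have := H (P.map f) (A.map f) (B.map f) (f x) (f m - 1) (f m) (by omega) (by omega)
          (by omega) hpos
        have hI := key (f m - 1) (f m) (by omega) (fun k hk => by have := hgt k hk; omega)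
          (fun k hk => by have := hPm k hk; omega)
        have hI2 := (hI.shift (by
            intro k hk
            rcases List.mem_append.mp hk with hc | hc
            · have := hgt _ hc; omega
            · simp at hc; omega)).shift (fun k hk => by have := hgt _ hk; omega)
        have hg := ih _ _ hw' hI2
        simpa using this (by simpa using hI.nodup) (by simpa using hg)

/-- Induction for `32★`. -/
theorem induction_32S :
    ∀ (n : ℕ) (P w : List ℕ), w.length = n → Pre P w → Good pat32S (P ++ w) := by
  intro n
  induction n with
  | zero =>
    intro P w hw h
    obtain rfl := List.length_eq_zero_iff.mp hw
    simpa using Good.of_sorted h.1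
  | succ n ih =>
    have aux : ∀ (c : ℕ) (P C B : List ℕ) (m : ℕ), C.length = c → (C ++ m :: B).length = n + 1 →
        Pre P (C ++ m :: B) → (∀ k ∈ C ++ B, m < k) → Good pat32S (P ++ (C ++ m :: B)) := by
      intro c
      induction c with
      | zero =>
        intro P C B m hc hw h hlt
        obtain rfl := List.length_eq_zero_iff.mp hc
        have := ih (P ++ [m]) B (by simpa using hw) (Pre.shift h hlt)
        simpa using this
      | succ c ihc =>
        intro P C B m hc hw h hlt
        rcases C with _ | ⟨z, A⟩
        · simp at hc
        apply Good.of_map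
        have hM := h.map
        have hz : m < z := hlt z (by simp)
        set f : ℕ → ℕ := fun k => 3 * k + 3 with hf
        have hperm : (((z :: A) ++ m :: B).map f).Perm
            (A.map f ++ f m :: f z :: B.map f) := by
          rw [List.perm_iff_count]; intro t
          simp only [List.map_append, List.map_cons, List.count_append, List.count_cons]; omega
        have hM1 := hM.perm hperm
        have hgt : ∀ k ∈ A.map f ++ f z :: B.map f, f m < k := by
          intro k hk
          have : k ∈ (A ++ z :: B).map f := by simpa using hk
          obtain ⟨q, hq, rfl⟩ := List.mem_map.mp this
          have := hlt q (by simp at hq ⊢; tauto)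
          simp only [hf]; omega
        have hge : ∀ k ∈ A.map f ++ f m :: f z :: B.map f, f m - 1 < k := by
          intro k hk
          by_cases hk' : k = f m
          · simp only [hk', hf]; omega
          · have := hgt k (by simp only [List.mem_append, List.mem_cons] at hk ⊢; tauto)
            omega
        have hpos : ∀ k ∈ P.map f ++ A.map f ++ [] ++ B.map f, 0 < k := by
          intro k hk
          have : k ∈ (P ++ A ++ B).map f := by simpa using hk
          obtain ⟨q, hq, rfl⟩ := List.mem_map.mp this
          simp only [hf]; omega
        have hPm : ∀ p ∈ P.map f, p < f m - 1 := by
          intro p hp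
          obtain ⟨q, hq, rfl⟩ := List.mem_map.mp hp
          have := h.2.2 q hq m (by simp)
          simp only [hf]; omega
        have hmz : f m < f z := by simp only [hf]; omega
        have hm0 : 2 < f m := by simp only [hf]; omega
        have hI : Pre (P.map f) ((f m - 1) :: (A.map f ++ f m :: f z :: B.map f)) :=
          hM1.insert hPm (fun hk => (hge _ hk).false)
        have hg := ihc _ (A.map f) (f z :: B.map f) (f m) (by simpa using hc)
          (by simp at hw ⊢; omega) (hI.shift hge) hgt
        have := step_32S (P.map f) (A.map f) [] (B.map f) (x := f m - 1) (y := f m) (z := f z)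
          (by omega) (by omega) hmz hpos (by simpa using hI.nodup) (by simpa using hg)
        simpa using this
    intro P w hw h
    obtain ⟨C, m, B, rfl, hm⟩ := exists_min w (by rintro rfl; simp at hw)
    exact aux _ P C B m rfl hw h (min_lt h.2.1 hm)

/-- Induction for `★21`. -/
theorem induction_S21 :
    ∀ (n : ℕ) (P w : List ℕ), w.length = n → Suf w P → Good patS21 (w ++ P) := by
  intro n
  induction n with
  | zero =>
    intro P w hw h
    obtain rfl := List.length_eq_zero_iff.mp hw
    simpa using Good.of_sorted h.1
  | succ n ih =>
    have aux : ∀ (c : ℕ) (P A C : List ℕ) (m : ℕ), C.length = c → (A ++ m :: C).length = n + 1 →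
        Suf (A ++ m :: C) P → (∀ k ∈ A ++ C, k < m) → Good patS21 (A ++ m :: C ++ P) := by
      intro c
      induction c with
      | zero =>
        intro P A C m hc hw h hlt
        obtain rfl := List.length_eq_zero_iff.mp hc
        have := ih (m :: P) A (by simpa using hw) (Suf.shift h (by simpa using hlt))
        simpa using this
      | succ c ihc =>
        intro P A C m hc hw h hlt
        rcases List.eq_nil_or_concat C with rfl | ⟨B, x, rfl⟩
        · simp at hc
        rw [List.concat_eq_append] at *
        apply Good.of_map
        have hM := h.map
        have hz : x < m := hlt x (by simp)
        set f : ℕ → ℕ := fun k => 3 * k + 3 with hf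
        have hperm : ((A ++ m :: (B ++ [x])).map f).Perm
            ((A.map f ++ [f x]) ++ f m :: B.map f) := by
          rw [List.perm_iff_count]; intro t
          simp only [List.map_append, List.map_cons, List.count_append, List.count_cons,
            List.map_nil, List.count_nil]; omega
        have hM1 := hM.perm hperm
        have hgt : ∀ k ∈ (A.map f ++ [f x]) ++ B.map f, k < f m := by
          intro k hk
          have : k ∈ (A ++ x :: B).map f := by simpa using hk
          obtain ⟨q, hq, rfl⟩ := List.mem_map.mp this
          have := hlt q (by simp at hq ⊢; tauto)
          simp only [hf]; omega
        have hge : ∀ k ∈ (A.map f ++ [f x]) ++ f m :: B.map f, k < f m + 1 := by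
          intro k hk
          by_cases hk' : k = f m
          · omega
          · have := hgt k (by simp only [List.mem_append, List.mem_cons] at hk ⊢; tauto)
            omega
        have hpos : ∀ k ∈ A.map f ++ [] ++ B.map f ++ P.map f, 0 < k := by
          intro k hk
          have : k ∈ (A ++ B ++ P).map f := by simpa using hk
          obtain ⟨q, hq, rfl⟩ := List.mem_map.mp this
          simp only [hf]; omega
        have hPm : ∀ p ∈ P.map f, f m + 1 < p := by
          intro p hp
          obtain ⟨q, hq, rfl⟩ := List.mem_map.mp hp
          have := h.2.2 q hq m (by simp)
          simp only [hf]; omega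
        have hmz : f x < f m := by simp only [hf]; omega
        have hm0 : 2 < f x := by simp only [hf]; omega
        have hI : Suf (((A.map f ++ [f x]) ++ f m :: B.map f) ++ [f m + 1]) (P.map f) :=
          (hM1.insert hPm (fun hk => (hge _ hk).false)).perm
            (List.perm_append_singleton _ _).symm
        have hg := ihc _ (A.map f ++ [f x]) (B.map f) (f m) (by simpa using hc)
          (by simp at hw ⊢; omega) (hI.shift hge) hgt
        have := step_S21 (A.map f) [] (B.map f) (P.map f) (x := f x) (y := f m) (z := f m + 1)
          (by omega) hmz (by omega) hpos (by simpa using hI.nodup) (by simpa using hg)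
        simpa using this
    intro P w hw h
    obtain ⟨C, m, B, rfl, hm⟩ := exists_max w (by rintro rfl; simp at hw)
    exact aux _ P C B m rfl hw h (lt_max h.2.1 hm)

theorem all_good (β : SPat) (hβ : β ∈ ([patS32, pat3S2, pat32S, patS31, pat3S1, pat31S,
            patS21, pat2S1, pat21S] : List SPat)) (w : List ℕ) (hw : w.Nodup) : Good β w := by
  have hp : Pre [] w := ⟨by simp, hw, by simp⟩
  have hs : Suf w [] := ⟨by simp, hw, by simp⟩
  simp only [List.mem_cons, List.not_mem_nil, or_false] at hβ
  rcases hβ with rfl | rfl | rfl | rfl | rfl | rfl | rfl | rfl | rfl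
  · have := prefix_induction patS32 (Or.inl (by
      intro P A B x y z h1 h2 h3 h4 h5 h6
      have := step_S32 P [] A B h1 h2 h3 (by simpa using h4) (by simpa using h5) (by simpa using h6)
      simpa using this)) _ [] w rfl hp
    simpa using this
  · have := prefix_induction pat3S2 (Or.inl (by
      intro P A B x y z h1 h2 h3 h4 h5 h6
      have := step_3S2 P [] A B h1 h2 h3 (by simpa using h4) (by simpa using h5) (by simpa using h6)
      simpa using this)) _ [] w rfl hp
    simpa using this
  · exact induction_32S _ [] w rfl hp
  · have := prefix_induction patS31 (Or.inr (by
      intro P A B x y z h1 h2 h3 h4 h5 h6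
      have := step_S31 P [] A B h1 h2 h3 (by simpa using h4) (by simpa using h5) (by simpa using h6)
      simpa using this)) _ [] w rfl hp
    simpa using this
  · have := prefix_induction pat3S1 (Or.inr (by
      intro P A B x y z h1 h2 h3 h4 h5 h6
      have := step_3S1 P [] A B h1 h2 h3 (by simpa using h4) (by simpa using h5) (by simpa using h6)
      simpa using this)) _ [] w rfl hp
    simpa using this
  · have := suffix_induction pat31S (Or.inr (by
      intro P A B x y z h1 h2 h3 h4 h5 h6
      have := step_31S A B [] P h1 h2 h3 (by simpa using h4) (by simpa using h5) (by simpa using h6)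
      simpa using this)) _ [] w rfl hs
    simpa using this
  · simpa using induction_S21 _ [] w rfl hs
  · have := suffix_induction pat2S1 (Or.inl (by
      intro P A B x y z h1 h2 h3 h4 h5 h6
      have := step_2S1 A B [] P h1 h2 h3 (by simpa using h4) (by simpa using h5) (by simpa using h6)
      simpa using this)) _ [] w rfl hs
    simpa using this
  · have := suffix_induction pat21S (Or.inl (by
      intro P A B x y z h1 h2 h3 h4 h5 h6
      have := step_21S A B [] P h1 h2 h3 (by simpa using h4) (by simpa using h5) (by simpa using h6)
      simpa using this)) _ [] w rfl hs
    simpa using this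

/-- for each of the nine ★-patterns `β` whose two integer entries
are in decreasing order, the replacement `123 ↔ β` has the unraveling property:
every permutation is equivalent to some identity permutation. -/
theorem decreasing_unraveling :
    ∀ β ∈ ([patS32, pat3S2, pat32S, patS31, pat3S1, pat31S,
            patS21, pat2S1, pat21S] : List SPat),
    ∀ π : List ℕ, IsPermList π → ∃ m : ℕ, PermEquiv pat123 β π (idPerm m) := by
  intro β hβ π hπ
  refine all_good β hβ π ?_ π hπ ⟨rfl, fun _ _ _ _ => Iff.rfl⟩
  exact hπ.nodup_iff.mpr List.nodup_range'
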